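/- arXiv:1409.6325 — 3 statements merged into one kernel-verified Lean document; each statement's English description precedes it below -/
import Mathlib

section
/- Let L be a finite simplicial complex of dimension k with vertices totally ordered as v_0 < v_1 < ⋯ < v_n, and order the vertices of OL by v_0^− < v_0^+ < v_1^− < v_1^+ < ⋯ < v_n^− < v_n^+. Let ν ∈ C^{2k}(C(OL);Z) be the van Kampen cocycle determined by the meshing condition and μ ∈ Z^{2k}(OL × L; Z) the cocycle determined by nonstrict meshing against the minus-copy of L. Then the pullback of μ under the chain map s: C_*(C(OL)) → C_*(OL × L), [σ,τ] ↦ (σ,p(τ)) + (−1)^{dim σ · dim τ}(τ,p(σ)), equals ν. -/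
open Finset

/-- An abstract simplicial complex on the vertex type `V`: a collection of nonempty
finite subsets of `V` (the simplices, or faces) closed under passing to nonempty subsets. -/
structure SCplx (V : Type) where
  faces : Set (Finset V)
  down_closed : ∀ ⦃s t : Finset V⦄, s ∈ faces → t ⊆ s → t.Nonempty → t ∈ faces
  nonempty_of_mem : ∀ ⦃s : Finset V⦄, s ∈ faces → s.Nonempty

variable {V : Type}

/-- `L` is a `k`-dimensional complex: every simplex has at most `k+1` vertices and
some simplex has exactly `k+1` vertices. -/
def IsDimOf (L : SCplx V) (k : ℕ) : Prop :=
  (∀ s ∈ L.faces, s.card ≤ k + 1) ∧ ∃ s ∈ L.faces, s.card = k + 1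

variable [DecidableEq V] in
/-- A flag complex: every nonempty set of pairwise adjacent vertices spans a simplex. -/
def IsFlag (L : SCplx V) : Prop :=
  ∀ s : Finset V, s.Nonempty →
    (∀ u ∈ s, ∀ w ∈ s, ({u, w} : Finset V) ∈ L.faces) → s ∈ L.faces

section Oct

variable [DecidableEq V]

/-- The projection `OL → L` on simplices, induced by `V × {±1} → V`
(`Bool` plays the role of `{±1}`, with `false` the minus sign). -/
def pface (s : Finset (V × Bool)) : Finset V := s.image Prod.fst

/-- The octahedralization `OL` of `L`: vertices are doubled, and a set of doubled
vertices spans a simplex iff its first coordinates are distinct and span a simplex of `L`. -/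
def oct (L : SCplx V) : SCplx (V × Bool) where
  faces := {s | pface s ∈ L.faces ∧ (pface s).card = s.card}
  down_closed := by
    rintro s t ⟨hf, hc⟩ hts hne
    refine ⟨L.down_closed hf (Finset.image_subset_image hts) ?_, ?_⟩
    · obtain ⟨x, hx⟩ := hne
      exact ⟨x.1, Finset.mem_image_of_mem _ hx⟩
    · rw [pface, Finset.card_image_iff] at hc ⊢
      exact hc.mono (Finset.coe_subset.mpr hts)
  nonempty_of_mem := by
    rintro s ⟨hf, hc⟩
    by_contra h
    rw [Finset.not_nonempty_iff_eq_empty] at h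
    subst h
    simp [pface] at hf
    exact absurd (L.nonempty_of_mem hf) (by simp)

/-- The full subcomplex of `K` on a set `A` of vertices. -/
def fullSub (K : SCplx V) (A : Finset V) : SCplx V where
  faces := {s | s ∈ K.faces ∧ s ⊆ A}
  down_closed := by
    rintro s t ⟨hs, hA⟩ hts ht
    exact ⟨K.down_closed hs hts ht, hts.trans hA⟩
  nonempty_of_mem := by
    rintro s ⟨hs, -⟩
    exact K.nonempty_of_mem hs

/-- The link of a simplex `σ` in `L`. -/
def scLink (L : SCplx V) (σ : Finset V) : SCplx V where
  faces := {τ | Disjoint σ τ ∧ σ ∪ τ ∈ L.faces ∧ τ.Nonempty}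
  down_closed := by
    rintro s t ⟨hd, hf, -⟩ hts ht
    refine ⟨hd.mono_right hts, L.down_closed hf (Finset.union_subset_union (subset_refl σ) hts) ?_, ht⟩
    obtain ⟨x, hx⟩ := ht
    exact ⟨x, Finset.mem_union_right _ hx⟩
  nonempty_of_mem := by
    rintro s ⟨-, -, h⟩
    exact h

/-- The closed star of a simplex `σ` in `L`; one has `St(σ) = Lk(σ) * σ`. -/
def scStar (L : SCplx V) (σ : Finset V) : SCplx V where
  faces := {τ | τ.Nonempty ∧ σ ∪ τ ∈ L.faces}
  down_closed := by
    rintro s t ⟨-, hf⟩ hts ht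
    refine ⟨ht, L.down_closed hf (Finset.union_subset_union (subset_refl σ) hts) ?_⟩
    obtain ⟨x, hx⟩ := ht
    exact ⟨x, Finset.mem_union_right _ hx⟩
  nonempty_of_mem := by
    rintro s ⟨h, -⟩
    exact h

end Oct

/-- The simplicial join of two complexes. -/
def scJoin {V₁ V₂ : Type} [DecidableEq V₁] [DecidableEq V₂]
    (K₁ : SCplx V₁) (K₂ : SCplx V₂) : SCplx (V₁ ⊕ V₂) where
  faces := {s | s.Nonempty ∧ ∃ (s₁ : Finset V₁) (s₂ : Finset V₂),
    s = s₁.image Sum.inl ∪ s₂.image Sum.inr ∧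
    (s₁ = ∅ ∨ s₁ ∈ K₁.faces) ∧ (s₂ = ∅ ∨ s₂ ∈ K₂.faces)}
  down_closed := by
    rintro s t ⟨hne, s₁, s₂, rfl, h₁, h₂⟩ hts htne
    refine ⟨htne, s₁.filter (fun v => Sum.inl v ∈ t), s₂.filter (fun v => Sum.inr v ∈ t),
      ?_, ?_, ?_⟩
    · ext x
      simp only [Finset.mem_union, Finset.mem_image, Finset.mem_filter]
      constructor
      · intro hx
        have hx' := hts hx
        simp only [Finset.mem_union, Finset.mem_image] at hx'
        rcases hx' with ⟨v, hv, rfl⟩ | ⟨v, hv, rfl⟩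
        · exact Or.inl ⟨v, ⟨hv, hx⟩, rfl⟩
        · exact Or.inr ⟨v, ⟨hv, hx⟩, rfl⟩
      · rintro (⟨v, ⟨hv, hvt⟩, rfl⟩ | ⟨v, ⟨hv, hvt⟩, rfl⟩) <;> assumption
    · by_cases h : s₁.filter (fun v => Sum.inl v ∈ t) = ∅
      · exact Or.inl h
      · right
        rcases h₁ with rfl | h₁
        · simp at h
        · exact K₁.down_closed h₁ (Finset.filter_subset _ _)
            (Finset.nonempty_iff_ne_empty.mpr h)
    · by_cases h : s₂.filter (fun v => Sum.inr v ∈ t) = ∅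
      · exact Or.inl h
      · right
        rcases h₂ with rfl | h₂
        · simp at h
        · exact K₂.down_closed h₂ (Finset.filter_subset _ _)
            (Finset.nonempty_iff_ne_empty.mpr h)
  nonempty_of_mem := by
    rintro s ⟨h, -⟩
    exact h

/-! ### Right-angled Artin groups -/

/-- The standard commutator relators of the right-angled Artin group on the 1-skeleton of `L`. -/
def raagRels [DecidableEq V] (L : SCplx V) : Set (FreeGroup V) :=
  {r | ∃ u w : V, u ≠ w ∧ ({u, w} : Finset V) ∈ L.faces ∧
    r = FreeGroup.of u * FreeGroup.of w * (FreeGroup.of u)⁻¹ * (FreeGroup.of w)⁻¹}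

/-- The right-angled Artin group `A_L` associated to a flag complex `L`:
one generator for each vertex, with commuting relations along the edges of `L`. -/
def RAAG [DecidableEq V] (L : SCplx V) : Type := PresentedGroup (raagRels L)

instance [DecidableEq V] (L : SCplx V) : Group (RAAG L) :=
  inferInstanceAs (Group (PresentedGroup (raagRels L)))

/-! ### Geometric realization -/

/-- The standard basis vertex placement for the geometric realization. -/
def stdVert [DecidableEq V] (v : V) : V → ℝ := fun w => if w = v then 1 else 0

/-- The geometric realization of an abstract simplicial complex, inside `V → ℝ`. -/
def realization [DecidableEq V] (L : SCplx V) : Set (V → ℝ) :=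
  ⋃ s ∈ L.faces, convexHull ℝ (stdVert '' (s : Set V))

/-! ### Action dimension and geometric dimension -/

/-- The action dimension of a group `Γ`: the least dimension of a contractible
(topological) manifold admitting a proper (i.e. properly discontinuous, by
homeomorphisms) `Γ`-action; `⊤` if there is no such manifold. -/
noncomputable def actdim (Γ : Type) [Group Γ] : ℕ∞ :=
  sInf {n : ℕ∞ | ∃ m : ℕ, n = (m : ℕ∞) ∧
    ∃ (M : Type) (_ : TopologicalSpace M) (_ : T2Space M)
      (_ : ChartedSpace (EuclideanSpace ℝ (Fin m)) M) (ρ : Γ →* Equiv.Perm M),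
      ContractibleSpace M ∧ (∀ γ : Γ, Continuous (⇑(ρ γ) : M → M)) ∧
      ∀ K L : Set M, IsCompact K → IsCompact L →
        {γ : Γ | ((⇑(ρ γ) : M → M) '' K ∩ L).Nonempty}.Finite}

/-- The geometric dimension of a group `Γ`: the least dimension of a (simplicial) model
for the classifying space `BΓ`, i.e. the least `m` such that `Γ` acts freely simplicially on
an `m`-dimensional contractible simplicial complex; `⊤` if there is no finite-dimensional
model. -/
noncomputable def gd (Γ : Type) [Group Γ] : ℕ∞ :=
  sInf {n : ℕ∞ | ∃ m : ℕ, n = (m : ℕ∞) ∧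
    ∃ (W : Type) (_ : DecidableEq W) (X : SCplx W) (ρ : Γ →* Equiv.Perm W),
      (∀ (γ : Γ), ∀ s ∈ X.faces, s.image (ρ γ) ∈ X.faces) ∧
      (∀ (γ : Γ), γ ≠ 1 → ∀ s ∈ X.faces, s.image (ρ γ) ≠ s) ∧
      (∀ s ∈ X.faces, s.card ≤ m + 1) ∧
      ContractibleSpace (realization X)}

/-! ### PL embeddings and embedding dimension -/

/-- A compact polyhedron in a real vector space: a finite union of polytopes. -/
def IsCompactPolyhedron {E : Type*} [AddCommGroup E] [Module ℝ E] (S : Set E) : Prop :=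
  ∃ F : Finset (Finset E), S = ⋃ t ∈ F, convexHull ℝ (t : Set E)

/-- A piecewise linear embedding of the compact polyhedron `P` into `Q`: an injective
map `P → Q` whose graph is a compact polyhedron. -/
def HasPLEmbedding {E₁ E₂ : Type*} [AddCommGroup E₁] [Module ℝ E₁]
    [AddCommGroup E₂] [Module ℝ E₂] (P : Set E₁) (Q : Set E₂) : Prop :=
  ∃ f : E₁ → E₂, Set.InjOn f P ∧ f '' P ⊆ Q ∧
    IsCompactPolyhedron {p : E₁ × E₂ | p.1 ∈ P ∧ p.2 = f p.1}

/-- The boundary complex of the `(m+1)`-simplex, a standard PL `m`-sphere. -/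
def sphereCplx (m : ℕ) : SCplx (Fin (m + 2)) where
  faces := {s | s.Nonempty ∧ s ≠ Finset.univ}
  down_closed := by
    rintro s t ⟨-, hs⟩ hts ht
    refine ⟨ht, fun h => hs ?_⟩
    exact Finset.univ_subset_iff.mp (h ▸ hts)
  nonempty_of_mem := fun _ h => h.1

/-- `K` embeds piecewise linearly in the sphere `S^m`. -/
def PLEmbedsInSphere [DecidableEq V] (K : SCplx V) (m : ℕ) : Prop :=
  HasPLEmbedding (realization K) (realization (sphereCplx m))

/-- The embedding dimension of `K`: the least `m` such that `K` piecewise linearly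
embeds in `S^m`. -/
noncomputable def embdim [DecidableEq V] (K : SCplx V) : ℕ :=
  sInf {m | PLEmbedsInSphere K m}

/-! ### Simplicial chains and homology mod 2 -/

/-- A simplicial `k`-chain with `ℤ/2` coefficients on `L`, recorded as its coefficient
function on finite vertex sets: it is supported on the `k`-simplices of `L`. -/
def IsChainOn (L : SCplx V) (k : ℕ) (c : Finset V → ZMod 2) : Prop :=
  ∀ s, c s ≠ 0 → s ∈ L.faces ∧ s.card = k + 1

/-- The mod 2 simplicial boundary operator (the coefficient of `∂c` on `t` is the sum
of the coefficients of `c` over the cofaces of `t`). -/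
noncomputable def bd2 [Fintype V] [DecidableEq V] (c : Finset V → ZMod 2) :
    Finset V → ZMod 2 :=
  fun t => ∑ x ∈ tᶜ, c (insert x t)

/-- `c` is a mod 2 simplicial `k`-cycle on `L`. -/
def IsCycleOn [Fintype V] [DecidableEq V] (L : SCplx V) (k : ℕ)
    (c : Finset V → ZMod 2) : Prop :=
  IsChainOn L k c ∧ ∀ t : Finset V, t.Nonempty → bd2 c t = 0

/-- `H_k(L; ℤ/2) ≠ 0`: there is a mod 2 `k`-cycle which is not a boundary. -/
def ModTwoHomologyNonzero [Fintype V] [DecidableEq V] (L : SCplx V) (k : ℕ) : Prop :=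
  ∃ c, IsCycleOn L k c ∧ ¬∃ d, IsChainOn L (k + 1) d ∧ bd2 d = c

/-! ### The van Kampen obstruction -/

/-- An (ordered) cell `σ × τ` of the simplicial deleted product of `K`. -/
def IsCell {W : Type} (K : SCplx W) (σ τ : Finset W) : Prop :=
  σ ∈ K.faces ∧ τ ∈ K.faces ∧ Disjoint σ τ

/-- An equivariant, augmentation-preserving chain map (mod 2) from the cellular chains of the
simplicial deleted product of `K` to the standard free resolution `W_*` of `ℤ/2` over
`ℤ/2[ℤ/2]` (the cellular chains of `S^∞ = EZ/2`); such a map classifies the free involution.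
The value on a cell `(σ,τ)` is the pair of coefficients of `e_n` and `Te_n`, `n = dim σ×τ`. -/
structure VKMap {W : Type} [DecidableEq W] (K : SCplx W) where
  f : Finset W × Finset W → ZMod 2 × ZMod 2
  supp : ∀ p : Finset W × Finset W, ¬ IsCell K p.1 p.2 → f p = 0
  symm : ∀ σ τ : Finset W, f (τ, σ) = (f (σ, τ)).swap
  aug : ∀ v w : W, IsCell K {v} {w} → (f ({v}, {w})).1 + (f ({v}, {w})).2 = 1
  chain : ∀ σ τ : Finset W, IsCell K σ τ → 3 ≤ σ.card + τ.card →
    ((∑ x ∈ σ, f (σ.erase x, τ)) + (∑ x ∈ τ, f (σ, τ.erase x))) =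
      ((f (σ, τ)).1 + (f (σ, τ)).2, (f (σ, τ)).1 + (f (σ, τ)).2)

/-- The pullback under `Φ` of the standard cocycle representing `w_1^m` on `RP^∞` is a
coboundary in the complex of symmetric (= `ℤ/2`-equivariant) cochains on the deleted
product, i.e. the class `vk^m_{ℤ/2}(K) = c^*(w_1^m) ∈ H^m(C(K); ℤ/2)` vanishes. -/
def vkClassVanishes {W : Type} [DecidableEq W] (K : SCplx W) (Φ : VKMap K) (m : ℕ) : Prop :=
  ∃ η : Finset W × Finset W → ZMod 2,
    (∀ p : Finset W × Finset W, ¬ IsCell K p.1 p.2 → η p = 0) ∧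
    (∀ σ τ : Finset W, η (τ, σ) = η (σ, τ)) ∧
    ∀ σ τ : Finset W, IsCell K σ τ → σ.card + τ.card = m + 2 →
      ((∑ x ∈ σ, η (σ.erase x, τ)) + (∑ x ∈ τ, η (σ, τ.erase x))) =
        (Φ.f (σ, τ)).1 + (Φ.f (σ, τ)).2

/-- Nonvanishing of the mod 2 van Kampen obstruction
`vk^m_{ℤ/2}(K) = c^*(w_1^m) ∈ H^m(C(K); ℤ/2)`. -/
def vkModTwoNonzero {W : Type} [DecidableEq W] (K : SCplx W) (m : ℕ) : Prop :=
  ∃ Φ : VKMap K, ¬ vkClassVanishes K Φ m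

/-- The van Kampen dimension of `K`: the largest `m` with `vk^m_{ℤ/2}(K) ≠ 0`
(with the usual conventions `vkdim ∅ = -2` and `vkdim(point) = -1`). -/
noncomputable def vkdim {W : Type} [DecidableEq W] (K : SCplx W) : ℤ :=
  sSup ({-2} ∪ {m : ℤ | (m = -1 ∧ K.faces.Nonempty) ∨
    ∃ n : ℕ, m = (n : ℤ) ∧ vkModTwoNonzero K n})

/-! ### The integral van Kampen obstruction -/

open Classical in
/-- The sign `(-1)^i` where `i` is the position of `x` in the simplex `σ` ordered by `lt`. -/
noncomputable def osign' {W : Type} (lt : W → W → Prop) (σ : Finset W) (x : W) : ℤ :=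
  (-1) ^ (σ.filter (fun y => lt y x)).card

/-- An equivariant, augmentation-preserving integral chain map from the cellular chains of
the simplicial deleted product of `K` (cells oriented by the order `lt`, the involution acting
with the sign `(-1)^{dim σ · dim τ}`) to the standard free resolution `W_*` of `ℤ` over
`ℤ[ℤ/2]` (with `∂e_n = e_{n-1} + (-1)^n Te_{n-1}`). -/
structure VKMapZ {W : Type} [DecidableEq W] (K : SCplx W) (lt : W → W → Prop) where
  f : Finset W × Finset W → ℤ × ℤ
  supp : ∀ p : Finset W × Finset W, ¬ IsCell K p.1 p.2 → f p = 0
  symm : ∀ σ τ : Finset W,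
    f (τ, σ) = ((-1 : ℤ) ^ ((σ.card - 1) * (τ.card - 1))) • (f (σ, τ)).swap
  aug : ∀ v w : W, IsCell K {v} {w} → (f ({v}, {w})).1 + (f ({v}, {w})).2 = 1
  chain : ∀ σ τ : Finset W, IsCell K σ τ → 3 ≤ σ.card + τ.card →
    ((∑ x ∈ σ, osign' lt σ x • f (σ.erase x, τ)) +
      ((-1 : ℤ) ^ (σ.card - 1)) • ∑ x ∈ τ, osign' lt τ x • f (σ, τ.erase x)) =
      ((f (σ, τ)).1 + (-1 : ℤ) ^ (σ.card + τ.card) * (f (σ, τ)).2,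
       (-1 : ℤ) ^ (σ.card + τ.card) * (f (σ, τ)).1 + (f (σ, τ)).2)

/-- The integral van Kampen class `vk^m(K) = c^*(e_1^m) ∈ H^m(C(K); ℤ)` (in even degree `m`)
vanishes: the pullback under `Φ` of the standard invariant cocycle generating
`H^m(RP^∞;ℤ)` is a coboundary of an invariant integral cochain. -/
def vkZClassVanishes {W : Type} [DecidableEq W] (K : SCplx W) (lt : W → W → Prop)
    (Φ : VKMapZ K lt) (m : ℕ) : Prop :=
  ∃ η : Finset W × Finset W → ℤ,
    (∀ p : Finset W × Finset W, ¬ IsCell K p.1 p.2 → η p = 0) ∧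
    (∀ σ τ : Finset W, η (τ, σ) = ((-1 : ℤ) ^ ((σ.card - 1) * (τ.card - 1))) * η (σ, τ)) ∧
    ∀ σ τ : Finset W, IsCell K σ τ → σ.card + τ.card = m + 2 →
      ((∑ x ∈ σ, osign' lt σ x * η (σ.erase x, τ)) +
        ((-1 : ℤ) ^ (σ.card - 1)) * ∑ x ∈ τ, osign' lt τ x * η (σ, τ.erase x)) =
        (Φ.f (σ, τ)).1 + (Φ.f (σ, τ)).2

/-- Nonvanishing of the integral van Kampen obstruction `vk^m(K) ∈ H^m(C(K); ℤ)`
(`m` even). -/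
def vkZNonzero {W : Type} [DecidableEq W] (K : SCplx W) (lt : W → W → Prop) (m : ℕ) : Prop :=
  ∃ Φ : VKMapZ K lt, ¬ vkZClassVanishes K lt Φ m

/-! ### Orders and meshing -/

/-- The order on the doubled vertices `V × {±1}`: `v⁻ < v⁺ < w⁻ < w⁺ < ⋯` for `v < w`
(`false` is the minus sign). -/
def olt [LT V] (a b : V × Bool) : Prop :=
  a.1 < b.1 ∨ (a.1 = b.1 ∧ a.2 = false ∧ b.2 = true)

/-- The reflexive closure of `olt`. -/
def ole [LT V] (a b : V × Bool) : Prop := olt a b ∨ a = b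

/-- `Meshed r s [v₀,…,v_k] [w₀,…,w_k]` says `r v₀ w₀`, `s w₀ v₁`, `r v₁ w₁`, `s w₁ v₂`, … ,
`r v_k w_k`, i.e. the two vertex lists alternate with respect to the relations `r`, `s`. -/
def Meshed {α : Type*} (r s : α → α → Prop) : List α → List α → Prop
  | [a], [b] => r a b
  | a :: a' :: l₁, b :: l₂ => r a b ∧ s b a' ∧ Meshed r s (a' :: l₁) l₂
  | _, _ => False

/-- `l` is the enumeration of the finite set `σ` in increasing order w.r.t. `r`. -/
def SListOf {α : Type*} [DecidableEq α] (r : α → α → Prop) (l : List α) (σ : Finset α) : Prop :=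
  l.toFinset = σ ∧ l.Chain' r

open Classical in
/-- The standard integral cocycle `ν` representing the top-degree van Kampen obstruction:
on an oriented cell `[σ,τ]` of `C(OL)` (simplices oriented by increasing vertex order)
it is `1` if `σ,τ` mesh, `(-1)^k` if `τ,σ` mesh, `0` otherwise. -/
noncomputable def nuVal [LinearOrder V] (k : ℕ) (σ τ : Finset (V × Bool)) : ℤ :=
  if ∃ l₁ l₂ : List (V × Bool), SListOf olt l₁ σ ∧ SListOf olt l₂ τ ∧ Meshed olt olt l₁ l₂
  then 1
  else if ∃ l₁ l₂ : List (V × Bool), SListOf olt l₁ σ ∧ SListOf olt l₂ τ ∧ Meshed olt olt l₂ l₁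
  then (-1) ^ k
  else 0

open Classical in
/-- The cocycle `μ ∈ Z^{2k}(OL × L; ℤ)`: its value on a cell `(σ, b)` is `1` if
`σ` meshes nonstrictly with the minus-copy `b⁻` of `b` (that is,
`v₀ ≤ w₀⁻ < v₁ ≤ w₁⁻ < ⋯ ≤ w_k⁻`), and `0` otherwise. -/
noncomputable def muVal [LinearOrder V] (σ : Finset (V × Bool)) (b : Finset V) : ℤ :=
  if ∃ (l₁ : List (V × Bool)) (l₂ : List V), SListOf olt l₁ σ ∧
      l₂.toFinset = b ∧ l₂.Chain' (· < ·) ∧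
      Meshed ole olt l₁ (l₂.map (fun w => (w, false)))
  then 1 else 0

/-! ### The chains `Ω`, `s_*`, and `OΔ × M` -/

open Classical in
/-- The vertices of (the support of) a mod 2 cycle `M`. -/
noncomputable def cycVerts [Fintype V] [DecidableEq V] (M : Finset V → ZMod 2) : Finset V :=
  Finset.univ.filter (fun v => ∃ s, M s ≠ 0 ∧ v ∈ s)

/-- The vertex set `M⁻ ∪ {v₀^±, …, v_k^±}` of `D`, the complex `M` doubled over `Δ`. -/
noncomputable def doubledVerts [Fintype V] [DecidableEq V] (M : Finset V → ZMod 2)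
    (Δ : Finset V) : Finset (V × Bool) :=
  (cycVerts M).image (fun v => (v, false)) ∪ Δ.image (fun v => (v, false)) ∪
    Δ.image (fun v => (v, true))

open Classical in
/-- The mod 2 chain `Ω ∈ C_{2k}(C(D); ℤ/2)` (as a symmetric function on ordered pairs):
a `2k`-cell `[σ,τ]` of `C(D)` lies in `Ω` iff `σ ∩ τ = ∅` and `Δ⁰ ⊆ p(σ) ∪ p(τ)`. -/
noncomputable def OmegaChain [DecidableEq V] (D : SCplx (V × Bool)) (Δ : Finset V) (k : ℕ) :
    Finset (V × Bool) × Finset (V × Bool) → ZMod 2 :=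
  fun p => if IsCell D p.1 p.2 ∧ p.1.card + p.2.card = 2 * k + 2 ∧
      Δ ⊆ pface p.1 ∪ pface p.2 then 1 else 0

open Classical in
/-- The pushforward under the chain map
`s : C_*(C(OL)) → C_*(OL × L)`, `[σ,τ] ↦ (σ, p(τ)) + (τ, p(σ))` (mod 2), of a mod 2 chain on
`C(OL)` given as a symmetric function on ordered pairs. -/
noncomputable def pushS [Fintype V] [DecidableEq V]
    (c : Finset (V × Bool) × Finset (V × Bool) → ZMod 2) :
    Finset (V × Bool) × Finset V → ZMod 2 :=
  fun q => ∑ τ : Finset (V × Bool), if pface τ = q.2 then c (q.1, τ) else 0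

open Classical in
/-- The mod 2 chain `OΔ × M ∈ C_{2k}(OL × L; ℤ/2)`. -/
noncomputable def chODeltaM [DecidableEq V] (Δ : Finset V) (M : Finset V → ZMod 2) (k : ℕ) :
    Finset (V × Bool) × Finset V → ZMod 2 :=
  fun q => if pface q.1 = Δ ∧ q.1.card = k + 1 then M q.2 else 0

/-- The mod 2 cellular boundary operator on chains of the configuration space `C(D)`
(symmetric functions on ordered pairs): `∂(σ × τ) = ∂σ × τ + σ × ∂τ`. -/
noncomputable def cBd2 [Fintype V] [DecidableEq V]
    (c : Finset (V × Bool) × Finset (V × Bool) → ZMod 2) :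
    Finset (V × Bool) × Finset (V × Bool) → ZMod 2 :=
  fun p => (∑ x ∈ p.1ᶜ, c (insert x p.1, p.2)) + (∑ x ∈ p.2ᶜ, c (p.1, insert x p.2))

/-- The `*`-condition for `(M, Δ)`: for all simplices `σ, τ` of `M` with
`Δ⁰ ⊆ σ ∪ τ` one has `σ ∩ τ ⊆ Δ`. -/
def StarCond [DecidableEq V] (M : Finset V → ZMod 2) (Δ : Finset V) : Prop :=
  ∀ σ τ : Finset V, M σ ≠ 0 → M τ ≠ 0 → Δ ⊆ σ ∪ τ → σ ∩ τ ⊆ Δ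

/-! ### Rational (reduced) simplicial homology -/

/-- The augmented rational simplicial boundary operator, on coefficient functions
`Finset V → ℚ` (the empty set plays the role of the `(-1)`-simplex, so this computes
reduced homology). -/
noncomputable def bdQ [Fintype V] [DecidableEq V] [LinearOrder V] :
    (Finset V → ℚ) →ₗ[ℚ] (Finset V → ℚ) where
  toFun c := fun t => ∑ x ∈ tᶜ, ((-1 : ℚ) ^ (t.filter (· < x)).card) * c (insert x t)
  map_add' a b := by
    funext t
    simp [mul_add, Finset.sum_add_distrib]
  map_smul' r a := by
    funext t
    simp only [RingHom.id_apply, Pi.smul_apply, smul_eq_mul]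
    rw [Finset.mul_sum]
    exact Finset.sum_congr rfl (fun x _ => by ring)

/-- The submodule of rational `k`-chains on `L`. -/
def chainsQ (L : SCplx V) (k : ℕ) : Submodule ℚ (Finset V → ℚ) where
  carrier := {c | ∀ s, c s ≠ 0 → s ∈ L.faces ∧ s.card = k + 1}
  add_mem' := by
    intro a b ha hb s hs
    by_cases h1 : a s = 0
    · by_cases h2 : b s = 0
      · exact absurd (by simp [h1, h2]) hs
      · exact hb s h2
    · exact ha s h1
  zero_mem' := by intro s hs; simp at hs
  smul_mem' := by
    intro r a ha s hs
    refine ha s (fun h => hs ?_)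
    simp [h]

/-- The reduced rational Betti number `b̄_k(L) = dim_ℚ H̃_k(L; ℚ)`. -/
noncomputable def redBetti [Fintype V] [DecidableEq V] [LinearOrder V]
    (L : SCplx V) (k : ℕ) : ℕ :=
  Module.finrank ℚ
    ((chainsQ L k ⊓ LinearMap.ker bdQ : Submodule ℚ (Finset V → ℚ)) ⧸
      (Submodule.comap (chainsQ L k ⊓ LinearMap.ker bdQ).subtype
        (Submodule.map bdQ (chainsQ L (k + 1)))))

/-! ### Integral simplicial cohomology in the top degree -/

open Classical in
/-- The integral simplicial coboundary operator into degree `k` cochains on `L`. -/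
noncomputable def cobOn [Fintype V] [DecidableEq V] [LinearOrder V] (L : SCplx V) (k : ℕ) :
    (Finset V → ℤ) →ₗ[ℤ] (Finset V → ℤ) where
  toFun φ := fun s => if s ∈ L.faces ∧ s.card = k + 1 then
      ∑ x ∈ s, ((-1 : ℤ) ^ (s.filter (· < x)).card) * φ (s.erase x) else 0
  map_add' a b := by
    funext s
    by_cases h : s ∈ L.faces ∧ s.card = k + 1 <;>
      simp [h, mul_add, Finset.sum_add_distrib]
  map_smul' r a := by
    funext s
    simp only [RingHom.id_apply, Pi.smul_apply, smul_eq_mul]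
    by_cases h : s ∈ L.faces ∧ s.card = k + 1
    · rw [if_pos h, if_pos h, Finset.mul_sum]
      exact Finset.sum_congr rfl (fun x _ => by ring)
    · rw [if_neg h, if_neg h, mul_zero]

/-- The submodule of integral `k`-cochains on `L` (functions supported on `k`-simplices). -/
def cochainsZ (L : SCplx V) (k : ℕ) : Submodule ℤ (Finset V → ℤ) where
  carrier := {c | ∀ s, c s ≠ 0 → s ∈ L.faces ∧ s.card = k + 1}
  add_mem' := by
    intro a b ha hb s hs
    by_cases h1 : a s = 0
    · by_cases h2 : b s = 0
      · exact absurd (by simp [h1, h2]) hs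
      · exact hb s h2
    · exact ha s h1
  zero_mem' := by intro s hs; simp at hs
  smul_mem' := by
    intro r a ha s hs
    refine ha s (fun h => hs ?_)
    simp [h]

open Classical in
/-- The submodule of integral `k`-coboundaries on `L`. -/
noncomputable def cobndZ [Fintype V] [DecidableEq V] [LinearOrder V]
    (L : SCplx V) (k : ℕ) : Submodule ℤ (Finset V → ℤ) :=
  if k = 0 then ⊥ else Submodule.map (cobOn L k) (cochainsZ L (k - 1))

/-- The top-degree integral simplicial cohomology `H^k(L; ℤ)` (for `k = dim L` every
`k`-cochain is a cocycle). -/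
noncomputable def topCohomologyZ [Fintype V] [DecidableEq V] [LinearOrder V]
    (L : SCplx V) (k : ℕ) :=
  (cochainsZ L k) ⧸ (Submodule.comap (cochainsZ L k).subtype (cobndZ L k))

noncomputable instance [Fintype V] [DecidableEq V] [LinearOrder V] (L : SCplx V) (k : ℕ) :
    AddCommGroup (topCohomologyZ L k) :=
  inferInstanceAs (AddCommGroup ((cochainsZ L k) ⧸
    (Submodule.comap (cochainsZ L k).subtype (cobndZ L k))))

/-- A space is aspherical if it admits a contractible covering space. -/
def IsAspherical (X : Type) [TopologicalSpace X] : Prop :=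
  ∃ (Y : Type) (_ : TopologicalSpace Y) (f : Y → X), IsCoveringMap f ∧ ContractibleSpace Y

theorem aux_uniq {α : Type*} (r : α → α → Prop) [IsTrans α r] [Std.Irrefl r]
    {l l' : List α} (h : l.IsChain r) (h' : l'.IsChain r) (hm : ∀ x, x ∈ l ↔ x ∈ l') : l = l' := by
  have hp := List.isChain_iff_pairwise.mp h
  have hp' := List.isChain_iff_pairwise.mp h'
  have hn : l.Nodup := hp.imp (fun {a b} hab e => by subst e; exact Std.Irrefl.irrefl a hab)
  have hn' : l'.Nodup := hp'.imp (fun {a b} hab e => by subst e; exact Std.Irrefl.irrefl a hab)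
  refine List.Perm.eq_of_pairwise (le := r) ?_ hp hp' ((List.perm_ext_iff_of_nodup hn hn').2 hm)
  intro a b _ _ hab hba
  exact absurd (_root_.trans hab hba) (Std.Irrefl.irrefl a)

instance auxTrans {V : Type} [LinearOrder V] : IsTrans (V × Bool) olt where
  trans := by
    rintro ⟨a, x⟩ ⟨b, y⟩ ⟨c, z⟩ h1 h2
    simp only [olt] at *
    rcases h1 with h1 | ⟨rfl, rfl, rfl⟩
    · rcases h2 with h2 | ⟨rfl, rfl, rfl⟩
      · exact Or.inl (h1.trans h2)
      · exact Or.inl h1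
    · rcases h2 with h2 | ⟨rfl, h, rfl⟩
      · exact Or.inl h2
      · simp at h

instance auxIrrefl {V : Type} [LinearOrder V] : Std.Irrefl (olt : V × Bool → V × Bool → Prop) where
  irrefl := by
    rintro ⟨a, x⟩ h
    simp only [olt] at h
    rcases h with h | ⟨_, rfl, h⟩
    · exact lt_irrefl _ h
    · simp at h

theorem aux_le {V : Type} [LinearOrder V] (a b : V × Bool) (h : a ≠ b) :
    ole a (b.1, false) ↔ olt a b := by
  obtain ⟨a, x⟩ := a
  obtain ⟨b, y⟩ := b
  cases x <;> cases y <;> simp_all [ole, olt] <;> grind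

theorem aux_lt {V : Type} [LinearOrder V] (a b : V × Bool) (h : a ≠ b) :
    olt (b.1, false) a ↔ olt b a := by
  obtain ⟨a, x⟩ := a
  obtain ⟨b, y⟩ := b
  cases x <;> cases y <;> simp_all [ole, olt] <;> grind

theorem aux_mesh {V : Type} [LinearOrder V] (l₁ l₂ : List (V × Bool))
    (h : ∀ x ∈ l₁, ∀ y ∈ l₂, x ≠ y) :
    Meshed ole olt l₁ ((l₂.map Prod.fst).map (fun w => (w, false))) ↔ Meshed olt olt l₁ l₂ := by
  induction l₂ generalizing l₁ with
  | nil => rcases l₁ with _ | ⟨a, _ | ⟨a', l⟩⟩ <;> simp [Meshed]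
  | cons b l₂ ih =>
    rcases l₁ with _ | ⟨a, _ | ⟨a', l⟩⟩
    · simp [Meshed]
    · have := aux_le a b (h a (by simp) b (by simp))
      cases l₂ <;> simp [Meshed, this]
    · have h1 := aux_le a b (h a (by simp) b (by simp))
      have h2 := aux_lt a' b (h a' (by simp) b (by simp))
      have h3 := ih (a' :: l) (fun x hx y hy => h x (List.mem_cons_of_mem _ hx) y
        (List.mem_cons_of_mem _ hy))
      simp only [List.map_cons, Meshed, h1, h2]
      simp only [h3]

theorem aux_asymm {V : Type} [LinearOrder V] (l₁ l₂ : List (V × Bool))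
    (h : Meshed olt olt l₁ l₂) (h' : Meshed olt olt l₂ l₁) : False := by
  have key : ∀ a b : V × Bool, olt a b → olt b a → False := fun a b h1 h2 =>
    (Std.Irrefl.irrefl (r := olt) a) (_root_.trans h1 h2)
  rcases l₁ with _ | ⟨a, _ | ⟨a', l⟩⟩ <;> rcases l₂ with _ | ⟨b, _ | ⟨b', m⟩⟩ <;>
    simp only [Meshed] at h h'
  · exact key _ _ h h'
  · exact key _ _ h.1 h'.1

theorem aux_list {V : Type} [LinearOrder V] (L : SCplx V) (σ : Finset (V × Bool))
    (hσ : σ ∈ (oct L).faces) :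
    ∃ l : List (V × Bool), (∀ x, x ∈ l ↔ x ∈ σ) ∧ l.IsChain olt ∧
      (l.map Prod.fst).IsChain (· < ·) := by
  have hinj : Set.InjOn Prod.fst (σ : Set (V × Bool)) := by
    have := hσ.2
    rwa [pface, Finset.card_image_iff] at this
  let g : V → V × Bool := fun v => (v, decide ((v, true) ∈ σ))
  have hs : ((pface σ).sort).IsChain (· < ·) :=
    List.isChain_iff_pairwise.mpr (Finset.sortedLT_sort (pface σ)).pairwise
  refine ⟨((pface σ).sort).map g, ?_, ?_, ?_⟩
  · have hg : ∀ x ∈ σ, g x.1 = x := by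
      rintro ⟨v, c⟩ hx
      cases c
      · have : (v, true) ∉ σ := fun h => by simpa using hinj h hx rfl
        simp [g, this]
      · simp [g, hx]
    intro x
    simp only [List.mem_map, Finset.mem_sort, pface, Finset.mem_image]
    constructor
    · rintro ⟨_, ⟨y, hy, rfl⟩, rfl⟩
      rwa [hg y hy]
    · intro hx
      exact ⟨x.1, ⟨x, hx, rfl⟩, hg x hx⟩
  · rw [List.isChain_map]
    exact hs.imp (fun a b hab => Or.inl hab)
  · rw [List.map_map]
    have : Prod.fst ∘ g = id := rfl
    rwa [this, List.map_id]

theorem pullback_mu_eq_nu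
    {V : Type} [Fintype V] [DecidableEq V] [LinearOrder V] (L : SCplx V) (k : ℕ)
    (hdim : IsDimOf L k) :
    ∀ σ τ : Finset (V × Bool), IsCell (oct L) σ τ →
      σ.card = k + 1 → τ.card = k + 1 →
      muVal σ (pface τ) + (-1 : ℤ) ^ ((σ.card - 1) * (τ.card - 1)) * muVal τ (pface σ) =
        nuVal k σ τ := by
  classical
  intro σ τ hc hσ hτ
  obtain rfl : ‹DecidableEq V› = LinearOrder.toDecidableEq := Subsingleton.elim _ _
  obtain ⟨hσf, hτf, hd⟩ := hc
  obtain ⟨l, hlm, hlc, hlf⟩ := aux_list L σ hσf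
  obtain ⟨m, hmm, hmc, hmf⟩ := aux_list L τ hτf
  have hS : ∀ (l : List (V × Bool)) (σ : Finset (V × Bool)), (∀ x, x ∈ l ↔ x ∈ σ) →
      l.IsChain olt → ∀ l', SListOf olt l' σ ↔ l' = l := by
    intro l σ h hc l'
    constructor
    · rintro ⟨h1, h2⟩
      refine aux_uniq olt h2 hc (fun x => ?_)
      rw [h, ← h1, List.mem_toFinset]
    · rintro rfl
      exact ⟨by ext x; rw [List.mem_toFinset, h], hc⟩
  have hM : ∀ (l m : List (V × Bool)) (σ τ : Finset (V × Bool)), Disjoint σ τ →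
      (∀ x, x ∈ l ↔ x ∈ σ) → l.IsChain olt → (∀ x, x ∈ m ↔ x ∈ τ) →
      (m.map Prod.fst).IsChain (· < ·) →
      ((∃ (l₁ : List (V × Bool)) (l₂ : List V), SListOf olt l₁ σ ∧
        l₂.toFinset = pface τ ∧ l₂.Chain' (· < ·) ∧
        Meshed ole olt l₁ (l₂.map (fun w => (w, false)))) ↔ Meshed olt olt l m) := by
    intro l m σ τ hd h1 h2 h3 h4
    rw [← aux_mesh l m (fun x hx y hy e => Finset.disjoint_left.mp hd ((h1 x).1 hx)
      (e ▸ (h3 y).1 hy))]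
    have hmem : ∀ x, x ∈ m.map Prod.fst ↔ x ∈ pface τ := by
      intro x
      simp only [List.mem_map, pface, Finset.mem_image, h3]
    constructor
    · rintro ⟨l₁, l₂, ha, hb, hc, hm⟩
      obtain rfl := (hS l σ h1 h2 l₁).1 ha
      have : l₂ = m.map Prod.fst := by
        refine aux_uniq (· < ·) hc h4 (fun x => ?_)
        rw [hmem, ← hb, List.mem_toFinset]
      rwa [← this]
    · intro hm
      exact ⟨l, m.map Prod.fst, (hS l σ h1 h2 l).2 rfl,
        by ext x; rw [List.mem_toFinset, hmem], h4, hm⟩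
  have hsign : (-1 : ℤ) ^ ((σ.card - 1) * (τ.card - 1)) = (-1) ^ k := by
    rw [hσ, hτ, Nat.add_sub_cancel, pow_mul]
    rcases Nat.even_or_odd k with h | h
    · simp [h.neg_one_pow]
    · simp [h.neg_one_pow]
  have e1 : (∃ l₁ l₂ : List (V × Bool), SListOf olt l₁ σ ∧ SListOf olt l₂ τ ∧
      Meshed olt olt l₁ l₂) ↔ Meshed olt olt l m := by
    simp only [hS l σ hlm hlc, hS m τ hmm hmc]
    simp
  have e2 : (∃ l₁ l₂ : List (V × Bool), SListOf olt l₁ σ ∧ SListOf olt l₂ τ ∧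
      Meshed olt olt l₂ l₁) ↔ Meshed olt olt m l := by
    simp only [hS l σ hlm hlc, hS m τ hmm hmc]
    simp
  have m1 := hM l m σ τ hd hlm hlc hmm hmf
  have m2 := hM m l τ σ hd.symm hmm hmc hlm hlf
  rw [hsign]
  have v1 : muVal σ (pface τ) = if Meshed olt olt l m then 1 else 0 := by
    unfold muVal
    exact if_congr m1 rfl rfl
  have v2 : muVal τ (pface σ) = if Meshed olt olt m l then 1 else 0 := by
    unfold muVal
    exact if_congr m2 rfl rfl
  have v3 : nuVal k σ τ = if Meshed olt olt l m then 1 else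
      if Meshed olt olt m l then (-1) ^ k else 0 := by
    unfold nuVal
    exact if_congr e1 rfl (if_congr e2 rfl rfl)
  rw [v1, v2, v3]
  by_cases a : Meshed olt olt l m
  · have b : ¬ Meshed olt olt m l := fun b => aux_asymm _ _ a b
    simp [a, b]
  · by_cases b : Meshed olt olt m l <;> simp [a, b]
end

section
/- Let L be a finite simplicial complex and suppose there exist a mod 2 k-cycle M ∈ Z_k(L;Z/2) and a k-simplex Δ ∈ M such that (M,Δ) satisfies the *-condition: for all k-simplices σ, τ ∈ M with Δ^0 ⊂ σ ∪ τ one has σ ∩ τ ⊂ Δ. Then the mod 2 van Kampen obstruction vk^{2k}_{Z/2}(OL) is nonzero, and hence vkdim OL ≥ 2k. -/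
open Finset

variable {V : Type}

namespace VKProof

/-- alternating indicator along the list `l`, starting in `σ` -/
def Q {W : Type} [DecidableEq W] : List W → Finset W → Finset W → ZMod 2
  | [], _, _ => 1
  | w :: l, σ, τ => if w ∈ σ then Q l τ σ else if w ∈ τ then 0 else Q l σ τ

section
variable {W : Type} [DecidableEq W]

lemma Q_congr (l : List W) : ∀ (σ τ σ' τ' : Finset W),
    (∀ x ∈ l, (x ∈ σ ↔ x ∈ σ') ∧ (x ∈ τ ↔ x ∈ τ')) → Q l σ τ = Q l σ' τ' := by
  induction l with
  | nil => intros; rfl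
  | cons w l ih =>
    intro σ τ σ' τ' h
    have h1 := h w (by simp)
    have h2 : ∀ x ∈ l, (x ∈ σ ↔ x ∈ σ') ∧ (x ∈ τ ↔ x ∈ τ') := fun x hx => h x (by simp [hx])
    simp only [Q, h1.1, h1.2]
    rw [ih σ τ σ' τ' h2, ih τ σ τ' σ' (fun x hx => (h2 x hx).symm)]

lemma Q_empty_left (l : List W) (τ : Finset W) (x : W) (hx : x ∈ l) (hxt : x ∈ τ) :
    Q l ∅ τ = 0 := by
  induction l with
  | nil => simp at hx
  | cons w l ih =>
    simp only [Q, notMem_empty, if_false]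
    by_cases hw : w ∈ τ
    · simp [hw]
    · simp only [hw, if_false]
      apply ih
      rcases List.mem_cons.1 hx with rfl | h
      · exact absurd hxt hw
      · exact h

lemma Q_empty_right (l : List W) (τ : Finset W) (x y : W) (hx : x ∈ l) (hxt : x ∈ τ)
    (hy : y ∈ l) (hyt : y ∈ τ) (hxy : x ≠ y) :
    Q l τ ∅ = 0 := by
  induction l with
  | nil => simp at hx
  | cons w l ih =>
    simp only [Q, notMem_empty, if_false]
    by_cases hw : w ∈ τ
    · simp only [hw, if_true]
      by_cases hwx : x = w
      · subst hwx
        refine Q_empty_left l τ y ?_ hyt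
        rcases List.mem_cons.1 hy with rfl | h
        · exact absurd rfl hxy
        · exact h
      · refine Q_empty_left l τ x ?_ hxt
        rcases List.mem_cons.1 hx with rfl | h
        · exact absurd rfl hwx
        · exact h
    · simp only [hw, if_false]
      apply ih
      · rcases List.mem_cons.1 hx with rfl | h
        · exact absurd hxt hw
        · exact h
      · rcases List.mem_cons.1 hy with rfl | h
        · exact absurd hyt hw
        · exact h

lemma Q_empty_empty (l : List W) : Q l ∅ ∅ = 1 := by
  induction l with
  | nil => rfl
  | cons w l ih => simp [Q, ih]

lemma Q_single (l : List W) (hl : l.Nodup) (v : W) : Q l {v} ∅ = 1 := by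
  induction l with
  | nil => rfl
  | cons w l ih =>
    rw [List.nodup_cons] at hl
    simp only [Q, mem_singleton, notMem_empty, if_false]
    by_cases hw : w = v
    · simp only [hw, if_true]
      rw [Q_congr l ∅ {v} ∅ ∅, Q_empty_empty]
      intro x hx
      simp only [mem_singleton, notMem_empty, true_and, iff_false]
      rintro rfl
      exact hl.1 (hw ▸ hx)
    · simp only [hw, if_false]
      exact ih hl.2

lemma z2_self (a : ZMod 2) : a + a = 0 := CharTwo.add_self_eq_zero a

lemma Q_der (l : List W) (hl : l.Nodup) : ∀ (σ τ : Finset W), Disjoint σ τ →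
    ∑ x ∈ l.toFinset, (if x ∈ σ ∪ τ then Q l (σ.erase x) (τ.erase x) else 0)
      = Q l σ τ + Q l τ σ := by
  induction l with
  | nil => intro σ τ _; simp [Q]; decide
  | cons w l ih =>
    intro σ τ hd
    rw [List.nodup_cons] at hl
    rw [List.toFinset_cons, Finset.sum_insert (by simpa using hl.1)]
    have h0 : Q (w :: l) (σ.erase w) (τ.erase w) = Q l σ τ := by
      simp only [Q, mem_erase, ne_eq, not_true, false_and, if_false]
      apply Q_congr
      intro x hx
      have : x ≠ w := by rintro rfl; exact hl.1 hx
      simp [this]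
    rw [h0]
    have hne : ∀ x ∈ l.toFinset, w ≠ x := by
      intro x hx; rintro rfl; exact hl.1 (by simpa using hx)
    by_cases h1 : w ∈ σ
    · have h2 : w ∉ τ := Finset.disjoint_left.1 hd h1
      have : ∑ x ∈ l.toFinset, (if x ∈ σ ∪ τ then Q (w :: l) (σ.erase x) (τ.erase x) else 0)
          = Q l τ σ + Q l σ τ := by
        rw [← ih hl.2 τ σ hd.symm]
        apply Finset.sum_congr rfl
        intro x hx
        simp [Q, hne x hx, h1, or_comm]
      rw [this]
      simp only [Q, h1, h2, mem_union, true_or, if_true, if_false]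
      have := z2_self (Q l σ τ)
      linear_combination this
    · by_cases h2 : w ∈ τ
      · have : ∑ x ∈ l.toFinset, (if x ∈ σ ∪ τ then Q (w :: l) (σ.erase x) (τ.erase x) else 0)
          = 0 := by
          apply Finset.sum_eq_zero
          intro x hx
          simp [Q, hne x hx, h1, h2]
        rw [this]
        simp [Q, h1, h2]
      · have : ∑ x ∈ l.toFinset, (if x ∈ σ ∪ τ then Q (w :: l) (σ.erase x) (τ.erase x) else 0)
          = Q l σ τ + Q l τ σ := by
          rw [← ih hl.2 σ τ hd]
          apply Finset.sum_congr rfl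
          intro x hx
          simp [Q, hne x hx, h1, h2]
        rw [this]
        simp [Q, h1, h2]

lemma Q_der2 (l : List W) (hl : l.Nodup) (hall : ∀ x, x ∈ l) (σ τ : Finset W)
    (hd : Disjoint σ τ) :
    (∑ x ∈ σ, Q l (σ.erase x) τ) + (∑ x ∈ τ, Q l σ (τ.erase x)) = Q l σ τ + Q l τ σ := by
  rw [← Q_der l hl σ τ hd, ← Finset.sum_filter]
  have : l.toFinset.filter (fun x => x ∈ σ ∪ τ) = σ ∪ τ := by
    ext x; simp [hall]
  rw [this, Finset.sum_union hd]
  congr 1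
  · apply Finset.sum_congr rfl
    intro x hx
    rw [Finset.erase_eq_of_notMem (Finset.disjoint_left.1 hd hx)]
  · apply Finset.sum_congr rfl
    intro x hx
    rw [Finset.erase_eq_of_notMem (Finset.disjoint_right.1 hd hx)]

open Classical in
/-- the meshing chain map -/
noncomputable def fQ (K : SCplx W) (l : List W) (p : Finset W × Finset W) : ZMod 2 × ZMod 2 :=
  if IsCell K p.1 p.2 then (Q l p.1 p.2, Q l p.2 p.1) else 0

lemma isCell_symm {K : SCplx W} {σ τ : Finset W} (h : IsCell K σ τ) : IsCell K τ σ :=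
  ⟨h.2.1, h.1, h.2.2.symm⟩

lemma fQ_of_left (K : SCplx W) (l : List W) (hall : ∀ x, x ∈ l) (σ τ : Finset W)
    (h : IsCell K σ τ) (hc : 3 ≤ σ.card + τ.card) (x : W) (hx : x ∈ σ) :
    fQ K l (σ.erase x, τ) = (Q l (σ.erase x) τ, Q l τ (σ.erase x)) := by
  by_cases he : (σ.erase x).Nonempty
  · have : IsCell K (σ.erase x) τ :=
      ⟨K.down_closed h.1 (Finset.erase_subset _ _) he, h.2.1,
        h.2.2.mono_left (Finset.erase_subset _ _)⟩
    simp [fQ, this]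
  · rw [Finset.not_nonempty_iff_eq_empty] at he
    have h1 : σ.card = 1 := by
      have := Finset.card_erase_add_one hx
      rw [he] at this; simpa using this.symm
    have h2 : 1 < τ.card := by omega
    obtain ⟨a, ha, b, hb, hab⟩ := Finset.one_lt_card.1 h2
    rw [he, Q_empty_left l τ a (hall a) ha, Q_empty_right l τ a b (hall a) ha (hall b) hb hab]
    have : ¬ IsCell K ∅ τ := fun h => by simpa using K.nonempty_of_mem h.1
    simp only [fQ, this, if_false]
    rfl

lemma fQ_swap (K : SCplx W) (l : List W) (σ τ : Finset W) :
    fQ K l (τ, σ) = (fQ K l (σ, τ)).swap := by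
  by_cases h : IsCell K σ τ
  · simp [fQ, h, isCell_symm h]
  · have h' : ¬ IsCell K τ σ := fun h' => h (isCell_symm h')
    simp [fQ, h, h']

/-- the classifying map -/
noncomputable def Phi (K : SCplx W) (l : List W) (hl : l.Nodup) (hall : ∀ x, x ∈ l) : VKMap K where
  f := fQ K l
  supp := by intro p h; simp [fQ, h]
  symm := fun σ τ => fQ_swap K l σ τ
  aug := by
    intro v w h
    have hne : v ≠ w := by simpa using h.2.2
    have := Q_der2 l hl hall {v} {w} h.2.2
    simp only [fQ, h, if_true]
    rw [← this]
    simp [Q_empty_left l {w} w (hall w) (by simp), Q_single l hl]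
  chain := by
    intro σ τ h hc
    have a1 : ∑ x ∈ σ, fQ K l (σ.erase x, τ) = ∑ x ∈ σ, (Q l (σ.erase x) τ, Q l τ (σ.erase x)) :=
      Finset.sum_congr rfl (fun x hx => fQ_of_left K l hall σ τ h hc x hx)
    have a2 : ∑ x ∈ τ, fQ K l (σ, τ.erase x) = ∑ x ∈ τ, (Q l σ (τ.erase x), Q l (τ.erase x) σ) := by
      apply Finset.sum_congr rfl
      intro x hx
      rw [fQ_swap, fQ_of_left K l hall τ σ (isCell_symm h) (by omega) x hx]
      rfl
    rw [a1, a2]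
    have e1 := Q_der2 l hl hall σ τ h.2.2
    have e2 := Q_der2 l hl hall τ σ h.2.2.symm
    ext
    · simp only [Prod.fst_add, Prod.fst_sum, fQ, h, if_true]
      exact e1
    · simp only [Prod.snd_add, Prod.snd_sum, fQ, h, if_true]
      rw [add_comm, e2, add_comm]

end

section
variable {V : Type} [DecidableEq V]

/-- doubled vertex list -/
def dl (lv : List V) : List (V × Bool) := lv.flatMap (fun v => [(v, false), (v, true)])

lemma dl_nodup (lv : List V) (h : lv.Nodup) : (dl lv).Nodup := by
  unfold dl
  rw [List.nodup_flatMap]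
  refine ⟨by simp, ?_⟩
  refine h.imp ?_
  intro a b hab
  simp [Function.onFun, List.Disjoint, hab]

lemma mem_dl (lv : List V) (h : ∀ v, v ∈ lv) (x : V × Bool) : x ∈ dl lv := by
  unfold dl
  rw [List.mem_flatMap]
  refine ⟨x.1, h _, ?_⟩
  rcases x with ⟨v, _ | _⟩ <;> simp

/-- exactly one of the two copies of `u` is in `σ` -/
def one (u : V) (σ : Finset (V × Bool)) : Prop := ((u, false) ∈ σ ↔ ¬ (u, true) ∈ σ)
/-- no copy of `u` is in `σ` -/
def non (u : V) (σ : Finset (V × Bool)) : Prop := (u, false) ∉ σ ∧ (u, true) ∉ σ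

lemma Q_dl_cons (u : V) (lv : List V) (σ τ : Finset (V × Bool)) :
    Q (dl (u :: lv)) σ τ = Q ((u, false) :: (u, true) :: dl lv) σ τ := rfl

lemma Q_flip (lv : List V) : ∀ σ τ σ' τ' : Finset (V × Bool),
    (∀ u ∈ lv, (∀ b, ((u, b) ∈ σ ↔ (u, b) ∈ σ') ∧ ((u, b) ∈ τ ↔ (u, b) ∈ τ')) ∨
      (one u σ ∧ one u σ' ∧ non u τ ∧ non u τ') ∨
      (one u τ ∧ one u τ' ∧ non u σ ∧ non u σ')) →
    Q (dl lv) σ τ = Q (dl lv) σ' τ' := by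
  induction lv with
  | nil => intros; rfl
  | cons u lv ih =>
    intro σ τ σ' τ' h
    have h1 := h u (by simp)
    have h2 := fun w (hw : w ∈ lv) => h w (List.mem_cons_of_mem _ hw)
    have e1 := ih σ τ σ' τ' h2
    have e2 := ih τ σ τ' σ' (by
      intro w hw
      rcases h2 w hw with h | h | h
      · exact Or.inl (fun b => (h b).symm)
      · exact Or.inr (Or.inr h)
      · exact Or.inr (Or.inl h))
    rw [Q_dl_cons, Q_dl_cons]
    simp only [Q, e1, e2]
    rcases h1 with h | ⟨h, h', g, g'⟩ | ⟨h, h', g, g'⟩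
    · simp only [(h true).1, (h true).2, (h false).1, (h false).2]
    · unfold one at h h'
      unfold non at g g'
      by_cases a : (u, true) ∈ σ <;> by_cases b : (u, true) ∈ σ' <;> simp [a, b] at h h' <;>
        simp [a, b, h, h', g, g']
    · unfold one at h h'
      unfold non at g g'
      by_cases a : (u, true) ∈ τ <;> by_cases b : (u, true) ∈ τ' <;> simp [a, b] at h h' <;>
        simp [a, b, h, h', g, g']

lemma Q_base (lv : List V) (σ τ : Finset (V × Bool))
    (h : ∀ u ∈ lv, (((u, false) ∈ σ ∧ (u, true) ∉ σ) ∧ (u, true) ∈ τ ∧ (u, false) ∉ τ) ∨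
      (non u σ ∧ non u τ)) : Q (dl lv) σ τ = 1 := by
  induction lv with
  | nil => rfl
  | cons u lv ih =>
    have e := ih (fun w hw => h w (List.mem_cons_of_mem _ hw))
    rw [Q_dl_cons]
    rcases h u (by simp) with h | ⟨h, h'⟩
    · simp [Q, h, e]
    · simp [Q, h.1, h.2, h'.1, h'.2, e]

lemma Q_base0 (lv : List V) (σ τ : Finset (V × Bool))
    (h : ∀ u ∈ lv, (((u, false) ∈ σ ∧ (u, true) ∉ σ) ∧ (u, true) ∈ τ ∧ (u, false) ∉ τ) ∨
      (((u, true) ∈ σ ∧ (u, false) ∉ σ) ∧ (u, false) ∈ τ ∧ (u, true) ∉ τ) ∨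
      (non u σ ∧ non u τ)) (v : V) (hv : v ∈ lv) (hv1 : (v, true) ∈ σ) : Q (dl lv) σ τ = 0 := by
  induction lv with
  | nil => simp at hv
  | cons u lv ih =>
    rw [Q_dl_cons]
    rcases h u (by simp) with g | g | ⟨g, g'⟩
    · have hvu : v ≠ u := by rintro rfl; exact g.1.2 hv1
      have e := ih (fun w hw => h w (List.mem_cons_of_mem _ hw)) (by simpa [hvu] using hv)
      simp [Q, g, e]
    · simp [Q, g]
    · have hvu : v ≠ u := by rintro rfl; exact g.2 hv1
      have e := ih (fun w hw => h w (List.mem_cons_of_mem _ hw)) (by simpa [hvu] using hv)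
      simp [Q, g.1, g.2, g'.1, g'.2, e]

lemma mem_pface (σ : Finset (V × Bool)) (v : V) :
    v ∈ pface σ ↔ (v, false) ∈ σ ∨ (v, true) ∈ σ := by
  simp [pface]

/-- at most one copy of each vertex -/
def inj (σ : Finset (V × Bool)) : Prop := ∀ v, ¬ ((v, false) ∈ σ ∧ (v, true) ∈ σ)

lemma inj_card (σ : Finset (V × Bool)) (h : inj σ) : (pface σ).card = σ.card := by
  rw [pface, Finset.card_image_iff]
  rintro ⟨a, b⟩ ha ⟨c, d⟩ hc (rfl : a = c)
  have := h a
  cases b <;> cases d <;> simp_all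

/-- simplex data in the doubled complex, apart from the cycle condition -/
def pre (Δ : Finset V) (σ : Finset (V × Bool)) : Prop :=
  inj σ ∧ ∀ v, (v, true) ∈ σ → v ∈ Δ

/-- cells of the cycle Ω -/
def Om (M : Finset V → ZMod 2) (Δ : Finset V) (σ τ : Finset (V × Bool)) : Prop :=
  pre Δ σ ∧ pre Δ τ ∧ M (pface σ) ≠ 0 ∧ M (pface τ) ≠ 0 ∧ Disjoint σ τ ∧ Δ ⊆ pface σ ∪ pface τ

lemma Om_symm {M : Finset V → ZMod 2} {Δ : Finset V} {σ τ : Finset (V × Bool)}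
    (h : Om M Δ σ τ) : Om M Δ τ σ :=
  ⟨h.2.1, h.1, h.2.2.2.1, h.2.2.1, h.2.2.2.2.1.symm, by rw [Finset.union_comm]; exact h.2.2.2.2.2⟩

lemma pface_insert (x : V × Bool) (ρ : Finset (V × Bool)) :
    pface (insert x ρ) = insert x.1 (pface ρ) := by
  simp [pface, Finset.image_insert]

lemma z2_ne (a : ZMod 2) (h : a ≠ 0) : a = 1 := by
  revert h; revert a; decide

lemma Om_insert {M : Finset V → ZMod 2} {Δ : Finset V} {ρ τ : Finset (V × Bool)} (v : V) (b : Bool)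
    (hv : v ∉ pface ρ) :
    Om M Δ (insert (v, b) ρ) τ ↔
      (pre Δ ρ ∧ pre Δ τ ∧ M (pface τ) ≠ 0 ∧ Disjoint ρ τ) ∧
      M (insert v (pface ρ)) ≠ 0 ∧ (b = true → v ∈ Δ) ∧ (v, b) ∉ τ ∧
      Δ ⊆ insert v (pface ρ) ∪ pface τ := by
  have hp : pre Δ (insert (v, b) ρ) ↔ pre Δ ρ ∧ (b = true → v ∈ Δ) := by
    rw [mem_pface] at hv
    unfold pre inj
    constructor
    · rintro ⟨h1, h2⟩
      refine ⟨⟨fun w hw => h1 w (by simp [hw]), fun w hw => h2 w (by simp [hw])⟩, ?_⟩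
      rintro rfl; exact h2 v (by simp)
    · rintro ⟨⟨h1, h2⟩, h3⟩
      refine ⟨?_, ?_⟩
      · intro w hw
        have := h1 w
        simp only [mem_insert, Prod.mk.injEq] at hw
        grind
      · intro w hw
        simp only [mem_insert, Prod.mk.injEq] at hw
        rcases hw with ⟨rfl, rfl⟩ | hw
        · exact h3 rfl
        · exact h2 w hw
  unfold Om
  rw [hp, pface_insert, Finset.disjoint_insert_left]
  tauto

open Classical in
lemma cyc [Fintype V] (M : Finset V → ZMod 2) (Δ : Finset V) 
    (hM : ∀ t : Finset V, t.Nonempty → bd2 M t = 0) (hstar : StarCond M Δ)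
    (ρ τ : Finset (V × Bool)) (hρ : ρ.Nonempty) :
    ∑ x : V × Bool, (if x ∉ ρ ∧ Om M Δ (insert x ρ) τ then (1 : ZMod 2) else 0) = 0 := by
  by_cases hg : pre Δ ρ ∧ pre Δ τ ∧ M (pface τ) ≠ 0 ∧ Disjoint ρ τ
  swap
  · apply Finset.sum_eq_zero
    rintro x -
    rw [if_neg]
    rintro ⟨hx, h1, h2, h3, h4, h5, h6⟩
    apply hg
    refine ⟨⟨fun w hw => h1.1 w (by simp [hw]), fun w hw => h1.2 w (by simp [hw])⟩, h2, h4, ?_⟩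
    exact h5.mono_left (Finset.subset_insert _ _)
  have hz : ∀ v ∈ pface ρ, ∀ b, ¬ ((v, b) ∉ ρ ∧ Om M Δ (insert (v, b) ρ) τ) := by
    rintro v hv b ⟨h1, h2⟩
    rw [mem_pface] at hv
    have := h2.1.1 v
    cases b <;> simp at this <;> grind
  have hn : ∀ v ∉ pface ρ, ∀ b, (v, b) ∉ ρ := by
    intro v hv b
    rw [mem_pface] at hv
    cases b <;> tauto
  have hOm : ∀ v ∉ pface ρ, ∀ b, ((v, b) ∉ ρ ∧ Om M Δ (insert (v, b) ρ) τ) ↔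
      (Δ ⊆ insert v (pface ρ) ∪ pface τ ∧ M (insert v (pface ρ)) ≠ 0 ∧ (b = true → v ∈ Δ) ∧
        (v, b) ∉ τ) := by
    intro v hv b
    rw [Om_insert v b hv]
    have := hn v hv b
    tauto
  rw [Fintype.sum_prod_type]
  simp only [Fintype.sum_bool]
  by_cases hc : Δ ⊆ pface ρ ∪ pface τ
  · have hne : (pface ρ).Nonempty := hρ.image _
    refine Eq.trans ?_ (hM (pface ρ) hne)
    unfold bd2
    rw [← Finset.sum_subset (Finset.subset_univ (pface ρ)ᶜ)]
    · apply Finset.sum_congr rfl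
      intro v hv
      rw [Finset.mem_compl] at hv
      have hsub : Δ ⊆ insert v (pface ρ) ∪ pface τ :=
        hc.trans (Finset.union_subset_union (Finset.subset_insert _ _) (subset_refl _))
      simp only [hOm v hv, hsub, true_and]
      by_cases hm : M (insert v (pface ρ)) = 0
      · simp [hm]
      · rw [z2_ne _ hm]
        have hs := hstar _ _ hm hg.2.2.1 hsub
        by_cases hvΔ : v ∈ Δ
        · have hvt : v ∈ pface τ := by
            have := hc hvΔ
            simpa [hv] using this
          rw [mem_pface] at hvt
          have := hg.2.1.1 v
          by_cases ha : (v, true) ∈ τ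
          · have hb : (v, false) ∉ τ := by tauto
            simp [ha, hb]
          · have hb : (v, false) ∈ τ := by tauto
            simp [ha, hb, hvΔ]
        · have hvt : v ∉ pface τ := fun h => hvΔ (hs (by simp [h]))
          rw [mem_pface] at hvt
          push Not at hvt
          simp [hvt, hvΔ]
    · intro v _ hv
      simp only [Finset.mem_compl, not_not] at hv
      rw [if_neg (hz v hv true), if_neg (hz v hv false), add_zero]
  · apply Finset.sum_eq_zero
    rintro v -
    by_cases hv : v ∈ pface ρ
    · rw [if_neg (hz v hv true), if_neg (hz v hv false), add_zero]
    simp only [hOm v hv]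
    by_cases hsub : Δ ⊆ insert v (pface ρ) ∪ pface τ
    · obtain ⟨u, hu, hu'⟩ := Finset.not_subset.1 hc
      have h1 := hsub hu
      have huv : u = v := by
        simp only [mem_union, mem_insert] at h1 hu'
        tauto
      subst huv
      have h2 : (u, false) ∉ τ ∧ (u, true) ∉ τ := by
        simp only [mem_union, not_or, mem_pface] at hu'
        exact hu'.2
      simp only [h2, hu, hsub, true_and]
      by_cases hm : M (insert u (pface ρ)) = 0
      · simp [hm]
      · simp [hm]; decide
    · simp only [hsub, false_and, if_false, add_zero]

open Classical in
lemma sumA [Fintype V] (M : Finset V → ZMod 2) (Δ : Finset V) 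
    (hM : ∀ t : Finset V, t.Nonempty → bd2 M t = 0) (hstar : StarCond M Δ)
    (η : Finset (V × Bool) × Finset (V × Bool) → ZMod 2) (h0 : ∀ τ, η (∅, τ) = 0) :
    ∑ p ∈ univ.filter (fun p : Finset (V × Bool) × Finset (V × Bool) => Om M Δ p.1 p.2),
      ∑ x ∈ p.1, η (p.1.erase x, p.2) = 0 := by
  rw [Finset.sum_filter, Fintype.sum_prod_type, Finset.sum_comm]
  apply Finset.sum_eq_zero
  rintro τ -
  have e : ∀ σ : Finset (V × Bool), (if Om M Δ σ τ then ∑ x ∈ σ, η (σ.erase x, τ) else 0)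
      = ∑ x : V × Bool, if x ∈ σ ∧ Om M Δ σ τ then η (σ.erase x, τ) else 0 := by
    intro σ
    split_ifs with h
    · simp [h]
    · simp [h]
  simp only [e]
  rw [Finset.sum_comm]
  have e2 : ∀ x : V × Bool,
      ∑ σ : Finset (V × Bool), (if x ∈ σ ∧ Om M Δ σ τ then η (σ.erase x, τ) else 0)
      = ∑ ρ : Finset (V × Bool), if x ∉ ρ ∧ Om M Δ (insert x ρ) τ then η (ρ, τ) else 0 := by
    intro x
    rw [← Finset.sum_filter, ← Finset.sum_filter]
    refine Finset.sum_bij' (fun σ _ => σ.erase x) (fun ρ _ => insert x ρ) ?_ ?_ ?_ ?_ ?_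
    · intro σ h
      simp only [mem_filter, mem_univ, true_and] at h ⊢
      rw [Finset.insert_erase h.1]
      exact ⟨by simp, h.2⟩
    · intro σ h
      simp only [mem_filter, mem_univ, true_and] at h ⊢
      exact ⟨by simp, h.2⟩
    · intro σ h
      simp only [mem_filter, mem_univ, true_and] at h
      exact Finset.insert_erase h.1
    · intro σ h
      simp only [mem_filter, mem_univ, true_and] at h
      exact Finset.erase_insert h.1
    · intros; rfl
  simp only [e2]
  rw [Finset.sum_comm]
  apply Finset.sum_eq_zero
  rintro ρ -
  rcases ρ.eq_empty_or_nonempty with rfl | hρ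
  · simp [h0]
  · have := cyc M Δ hM hstar ρ τ hρ
    have h3 := congrArg (fun z => z * η (ρ, τ)) this
    simp only [Finset.sum_mul, zero_mul, ite_mul, one_mul] at h3
    exact h3

/-- flip the sign of the copies of `v` -/
def flipE (v : V) (x : V × Bool) : V × Bool := if x.1 = v then (x.1, !x.2) else x

lemma flipE_invol (v : V) (x : V × Bool) : flipE v (flipE v x) = x := by
  unfold flipE; by_cases h : x.1 = v <;> simp [h]
  rw [← h]

lemma mem_flip (v : V) (σ : Finset (V × Bool)) (x : V × Bool) :
    x ∈ σ.image (flipE v) ↔ flipE v x ∈ σ := by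
  rw [Finset.mem_image]
  constructor
  · rintro ⟨y, hy, rfl⟩; rwa [flipE_invol]
  · intro h; exact ⟨_, h, flipE_invol v x⟩

lemma mem_flip_same (v : V) (σ : Finset (V × Bool)) (b : Bool) :
    (v, b) ∈ σ.image (flipE v) ↔ (v, !b) ∈ σ := by
  rw [mem_flip]; simp [flipE]

lemma mem_flip_ne (v u : V) (h : u ≠ v) (σ : Finset (V × Bool)) (b : Bool) :
    (u, b) ∈ σ.image (flipE v) ↔ (u, b) ∈ σ := by
  rw [mem_flip]; simp [flipE, h]

lemma pface_flip (v : V) (σ : Finset (V × Bool)) : pface (σ.image (flipE v)) = pface σ := by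
  ext u
  rw [mem_pface, mem_pface]
  by_cases h : u = v
  · subst h; simp only [mem_flip_same]; simp [or_comm]
  · simp only [mem_flip_ne v u h]

lemma flip_flip (v : V) (σ : Finset (V × Bool)) : (σ.image (flipE v)).image (flipE v) = σ := by
  ext x; rw [mem_flip, mem_flip, flipE_invol]

lemma pre_flip (v : V) (Δ : Finset V) (hv : v ∈ Δ) (σ : Finset (V × Bool)) (h : pre Δ σ) :
    pre Δ (σ.image (flipE v)) := by
  refine ⟨?_, ?_⟩
  · intro u
    by_cases hu : u = v
    · subst hu; simp only [mem_flip_same]; have := h.1 u; simp; tauto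
    · simp only [mem_flip_ne v u hu]; exact h.1 u
  · intro u
    by_cases hu : u = v
    · subst hu; exact fun _ => hv
    · simp only [mem_flip_ne v u hu]; exact h.2 u

lemma Om_flip (M : Finset V → ZMod 2) (v : V) (Δ : Finset V) (hv : v ∈ Δ) (σ τ : Finset (V × Bool))
    (h : Om M Δ σ τ) : Om M Δ (σ.image (flipE v)) (τ.image (flipE v)) := by
  refine ⟨pre_flip v Δ hv σ h.1, pre_flip v Δ hv τ h.2.1, ?_, ?_, ?_, ?_⟩
  · rw [pface_flip]; exact h.2.2.1
  · rw [pface_flip]; exact h.2.2.2.1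
  · rw [Finset.disjoint_left]
    intro x h1 h2
    rw [mem_flip] at h1 h2
    exact Finset.disjoint_left.1 h.2.2.2.2.1 h1 h2
  · rw [pface_flip, pface_flip]; exact h.2.2.2.2.2

lemma one_or_non (σ : Finset (V × Bool)) (h : inj σ) (v : V) :
    (v ∈ pface σ → one v σ ∧ one v (σ.image (flipE v))) ∧
    (v ∉ pface σ → non v σ ∧ non v (σ.image (flipE v))) := by
  have := h v
  rw [mem_pface]
  unfold one non
  simp only [mem_flip_same]
  simp
  tauto

lemma Q_flip' (lv : List V) (v : V) (σ τ : Finset (V × Bool)) (hσ : inj σ) (hτ : inj τ)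
    (hv : (v ∈ pface σ ∧ v ∉ pface τ) ∨ (v ∈ pface τ ∧ v ∉ pface σ)) :
    Q (dl lv) (σ.image (flipE v)) (τ.image (flipE v)) = Q (dl lv) σ τ := by
  symm
  apply Q_flip
  intro u _
  by_cases hu : u = v
  · subst hu
    right
    have h1 := one_or_non σ hσ u
    have h2 := one_or_non τ hτ u
    tauto
  · left
    intro b
    simp only [mem_flip_ne v u hu]
    tauto

open Classical in
lemma sumQ [Fintype V] (M : Finset V → ZMod 2) (Δ : Finset V) (k : ℕ)
    (hk : ∀ s, M s ≠ 0 → s.card = k + 1) (hΔ : M Δ ≠ 0)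
    (lv : List V) (hlv : ∀ v, v ∈ lv) :
    ∑ p ∈ univ.filter (fun p : Finset (V × Bool) × Finset (V × Bool) => Om M Δ p.1 p.2),
      Q (dl lv) p.1 p.2 = 1 := by
  rw [← Finset.sum_filter_add_sum_filter_not _
    (fun p : Finset (V × Bool) × Finset (V × Bool) => ∃ v ∈ Δ, ¬ (v ∈ pface p.1 ∧ v ∈ pface p.2))]
  have e1 : ∑ p ∈ (univ.filter (fun p : Finset (V × Bool) × Finset (V × Bool) =>
        Om M Δ p.1 p.2)).filter (fun p => ∃ v ∈ Δ, ¬ (v ∈ pface p.1 ∧ v ∈ pface p.2)),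
      Q (dl lv) p.1 p.2 = 0 := by
    rcases isEmpty_or_nonempty V with hV | hV
    · apply Finset.sum_eq_zero
      intro p hp
      obtain ⟨v, -⟩ := (Finset.mem_filter.1 hp).2
      exact (hV.false v).elim
    let c : Finset V → Finset V → V := fun s t =>
      Classical.epsilon (fun v => v ∈ Δ ∧ ¬ (v ∈ s ∧ v ∈ t))
    have hc : ∀ s t, (∃ v ∈ Δ, ¬ (v ∈ s ∧ v ∈ t)) → c s t ∈ Δ ∧ ¬ (c s t ∈ s ∧ c s t ∈ t) :=
      fun s t h => Classical.epsilon_spec h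
    have hc2 : ∀ p : Finset (V × Bool) × Finset (V × Bool), Om M Δ p.1 p.2 →
        (∃ v ∈ Δ, ¬ (v ∈ pface p.1 ∧ v ∈ pface p.2)) →
        c (pface p.1) (pface p.2) ∈ Δ ∧
        ((c (pface p.1) (pface p.2) ∈ pface p.1 ∧ c (pface p.1) (pface p.2) ∉ pface p.2) ∨
        (c (pface p.1) (pface p.2) ∈ pface p.2 ∧ c (pface p.1) (pface p.2) ∉ pface p.1)) := by
      intro p hp h
      obtain ⟨h1, h2⟩ := hc _ _ h
      refine ⟨h1, ?_⟩
      have := hp.2.2.2.2.2 h1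
      rw [mem_union] at this
      tauto
    refine Finset.sum_involution (fun p _ =>
      (p.1.image (flipE (c (pface p.1) (pface p.2))),
        p.2.image (flipE (c (pface p.1) (pface p.2))))) ?_ ?_ ?_ ?_
    · intro p hp
      simp only [mem_filter, mem_univ, true_and] at hp
      simp only []
      rw [Q_flip' lv _ _ _ hp.1.1.1 hp.1.2.1.1 (hc2 p hp.1 hp.2).2]
      exact z2_self _
    · intro p hp _ heq
      simp only [mem_filter, mem_univ, true_and] at hp
      have key : ∀ (v : V) (σ : Finset (V × Bool)), inj σ → v ∈ pface σ →
          σ.image (flipE v) ≠ σ := by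
        intro v σ hi hv he
        have h1 := mem_flip_same v σ true
        rw [he] at h1
        rw [mem_pface] at hv
        have := hi v
        simp at h1
        tauto
      have e1 := congrArg Prod.fst heq
      have e2 := congrArg Prod.snd heq
      rcases (hc2 p hp.1 hp.2).2 with h | h
      · exact key _ _ hp.1.1.1 h.1 e1
      · exact key _ _ hp.1.2.1.1 h.1 e2
    · intro p hp
      simp only [mem_filter, mem_univ, true_and] at hp ⊢
      refine ⟨Om_flip M _ Δ (hc2 p hp.1 hp.2).1 _ _ hp.1, ?_⟩
      simp only [pface_flip]
      exact hp.2
    · intro p hp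
      simp only [pface_flip, flip_flip]
  rw [e1, zero_add]
  have hmm : ∀ v b, (v, b) ∈ Δ.image (fun v => (v, false)) ↔ v ∈ Δ ∧ b = false := by
    intro v b; simp [eq_comm]
  have hmp : ∀ v b, (v, b) ∈ Δ.image (fun v => (v, true)) ↔ v ∈ Δ ∧ b = true := by
    intro v b; simp [eq_comm]
  have pm : pface (Δ.image (fun v => (v, false))) = Δ := by
    ext v; rw [mem_pface, hmm, hmm]; simp
  have pp : pface (Δ.image (fun v => (v, true))) = Δ := by
    ext v; rw [mem_pface, hmp, hmp]; simp
  rw [Finset.sum_eq_single_of_mem (Δ.image (fun v => (v, false)), Δ.image (fun v => (v, true)))]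
  · apply Q_base
    intro u _
    unfold non
    simp only [hmm, hmp]
    by_cases hu : u ∈ Δ <;> simp [hu]
  · simp only [mem_filter, mem_univ, true_and]
    refine ⟨⟨⟨?_, ?_⟩, ⟨?_, ?_⟩, ?_, ?_, ?_, ?_⟩, ?_⟩
    · intro v; simp only [hmm]; simp
    · intro v; simp only [hmm]; simp
    · intro v; simp only [hmp]; simp
    · intro v; simp only [hmp]; simp
    · rw [pm]; exact hΔ
    · rw [pp]; exact hΔ
    · rw [Finset.disjoint_left]
      rintro ⟨v, b⟩ h1 h2
      rw [hmm] at h1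
      rw [hmp] at h2
      simp [h1.2] at h2
    · rw [pm]; exact Finset.subset_union_left
    · rw [pm, pp]; push Not; intro v hv; exact ⟨hv, hv⟩
  · rintro ⟨σ, τ⟩ hp hne
    simp only [mem_filter, mem_univ, true_and] at hp
    obtain ⟨hO, hall⟩ := hp
    push Not at hall
    have hcard : ∀ s : Finset (V × Bool), M (pface s) ≠ 0 → Δ ⊆ pface s → pface s = Δ := by
      intro s hs hsub
      have := hk _ hs
      exact (Finset.eq_of_subset_of_card_le hsub (by rw [hk _ hs, hk _ hΔ])).symm
    have pσ : pface σ = Δ := hcard σ hO.2.2.1 (fun v hv => (hall v hv).1)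
    have pτ : pface τ = Δ := hcard τ hO.2.2.2.1 (fun v hv => (hall v hv).2)
    have hcase : ∀ u, (((u, false) ∈ σ ∧ (u, true) ∉ σ) ∧ (u, true) ∈ τ ∧ (u, false) ∉ τ) ∨
      (((u, true) ∈ σ ∧ (u, false) ∉ σ) ∧ (u, false) ∈ τ ∧ (u, true) ∉ τ) ∨
      (non u σ ∧ non u τ) := by
      intro u
      have h1 := mem_pface σ u
      have h2 := mem_pface τ u
      rw [pσ] at h1
      rw [pτ] at h2
      have i1 := hO.1.1 u
      have i2 := hO.2.1.1 u
      have d1 : (u, false) ∈ σ → (u, false) ∉ τ := fun h => Finset.disjoint_left.1 hO.2.2.2.2.1 h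
      have d2 : (u, true) ∈ σ → (u, true) ∉ τ := fun h => Finset.disjoint_left.1 hO.2.2.2.2.1 h
      unfold non
      tauto
    by_cases hex : ∃ v, (v, true) ∈ σ
    · obtain ⟨v, hv⟩ := hex
      exact Q_base0 lv σ τ (fun u _ => hcase u) v (hlv v) hv
    · exfalso
      push Not at hex
      apply hne
      have hs : ∀ u, u ∈ Δ ↔ (u, false) ∈ σ := by
        intro u
        rw [← pσ, mem_pface]
        simp [hex]
      have ht : ∀ u, (u ∈ Δ ↔ (u, true) ∈ τ) ∧ (u, false) ∉ τ := by
        intro u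
        rw [hs u]
        rcases hcase u with h1 | h1 | h1
        · simp [h1]
        · exact absurd h1.1.1 (hex u)
        · simp [h1.1.1, h1.2.1, h1.2.2]
      ext ⟨u, b⟩
      · rw [hmm]
        cases b
        · simp [hs]
        · simp [hex]
      · rw [hmp]
        cases b
        · simp [ht]
        · simp [ht]

open Classical in
lemma main [Fintype V] (L : SCplx V) (k : ℕ)
    (M : Finset V → ZMod 2) (hM : IsCycleOn L k M) (Δ : Finset V) (hΔ : M Δ ≠ 0)
    (hstar : StarCond M Δ) : vkModTwoNonzero (oct L) (2 * k) := by
  have hlv : ∀ v : V, v ∈ (univ : Finset V).toList := by simp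
  refine ⟨Phi (oct L) (dl (univ : Finset V).toList) (dl_nodup _ (Finset.nodup_toList _))
    (mem_dl _ hlv), ?_⟩
  rintro ⟨η, hs, hsy, hη⟩
  have hA := sumA M Δ hM.2 hstar η (by
    intro τ
    apply hs
    intro h
    simpa using (oct L).nonempty_of_mem h.1)
  have hQ := sumQ M Δ k (fun s hs => (hM.1 s hs).2) hΔ _ hlv
  have hcell : ∀ σ τ, Om M Δ σ τ → IsCell (oct L) σ τ ∧ σ.card = k + 1 ∧ τ.card = k + 1 := by
    intro σ τ h
    have c1 := inj_card σ h.1.1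
    have c2 := inj_card τ h.2.1.1
    have m1 := hM.1 _ h.2.2.1
    have m2 := hM.1 _ h.2.2.2.1
    exact ⟨⟨⟨m1.1, c1⟩, ⟨m2.1, c2⟩, h.2.2.2.2.1⟩, c1 ▸ m1.2, c2 ▸ m2.2⟩
  have hsum : ∑ p ∈ univ.filter (fun p : Finset (V × Bool) × Finset (V × Bool) => Om M Δ p.1 p.2),
      ((∑ x ∈ p.1, η (p.1.erase x, p.2)) + Q (dl (univ : Finset V).toList) p.1 p.2) = 0 := by
    refine Finset.sum_involution (fun p _ => (p.2, p.1)) ?_ ?_ ?_ ?_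
    · rintro ⟨σ, τ⟩ hp
      simp only [mem_filter, mem_univ, true_and] at hp
      obtain ⟨hc, k1, k2⟩ := hcell _ _ hp
      have := hη σ τ hc (by omega)
      simp only [Phi, fQ, hc, if_true] at this
      rw [Finset.sum_congr rfl (fun x _ => hsy (τ.erase x) σ)] at this
      simp only []
      have e : ∀ a b c d : ZMod 2, a + b = c + d → a + c + (b + d) = 0 := by decide
      exact e _ _ _ _ this
    · rintro ⟨σ, τ⟩ hp _ heq
      simp only [mem_filter, mem_univ, true_and] at hp
      obtain ⟨hc, k1, k2⟩ := hcell _ _ hp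
      have h1 : τ = σ := congrArg Prod.fst heq
      have hd := hc.2.2
      rw [h1, disjoint_self, Finset.bot_eq_empty] at hd
      simp [hd] at k1
    · rintro ⟨σ, τ⟩ hp
      simp only [mem_filter, mem_univ, true_and] at hp ⊢
      exact Om_symm hp
    · rintro ⟨σ, τ⟩ hp; rfl
  rw [Finset.sum_add_distrib, hA, hQ] at hsum
  simp at hsum

lemma bound {W : Type} [Fintype W] [DecidableEq W] (K : SCplx W) (n : ℕ)
    (h : vkModTwoNonzero K n) : n ≤ 2 * Fintype.card W := by
  obtain ⟨Φ, hΦ⟩ := h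
  by_contra hn
  apply hΦ
  refine ⟨fun _ => 0, fun _ _ => rfl, fun _ _ => rfl, ?_⟩
  intro σ τ _ hc
  have := Finset.card_le_univ σ
  have := Finset.card_le_univ τ
  omega

end
end VKProof

theorem vkModTwo_nonzero_of_starCond
    {V : Type} [Fintype V] [DecidableEq V] (L : SCplx V) (k : ℕ)
    (M : Finset V → ZMod 2) (hM : IsCycleOn L k M) (Δ : Finset V) (hΔ : M Δ ≠ 0)
    (hstar : StarCond M Δ) :
    vkModTwoNonzero (oct L) (2 * k) ∧ 2 * (k : ℤ) ≤ vkdim (oct L) := by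
  have h := VKProof.main L k M hM Δ hΔ hstar
  refine ⟨h, ?_⟩
  apply le_csSup
  · refine ⟨2 * Fintype.card (V × Bool), ?_⟩
    rintro m (hm | ⟨hm, -⟩ | ⟨n, rfl, hn⟩)
    · have : m = -2 := hm
      omega
    · omega
    · have := VKProof.bound _ n hn
      exact_mod_cast this
  · right; right
    exact ⟨2 * k, by push_cast; rfl, h⟩
end

section
/- If L is a flag complex of dimension k, then every mod 2 k-cycle M ∈ Z_k(L;Z/2) of top degree and every k-simplex Δ of M satisfy the *-condition: for all k-simplices σ, τ ∈ M with Δ^0 ⊂ σ ∪ τ one has σ ∩ τ ⊂ Δ. -/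
open Finset

variable {V : Type}

theorem starCond_of_flag
    {V : Type} [Fintype V] [DecidableEq V] (L : SCplx V) (k : ℕ)
    (hflag : IsFlag L) (hdim : IsDimOf L k)
    (M : Finset V → ZMod 2) (hM : IsCycleOn L k M) (Δ : Finset V) (hΔ : M Δ ≠ 0) :
    StarCond M Δ := by
  intro σ τ hσ hτ hsub v hv
  rw [Finset.mem_inter] at hv
  by_contra hvΔ
  obtain ⟨hΔf, hΔc⟩ := hM.1 Δ hΔ
  have hσf := (hM.1 σ hσ).1
  have hτf := (hM.1 τ hτ).1
  have key : ∀ u ∈ insert v Δ, ({v, u} : Finset V) ∈ L.faces := by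
    intro u hu
    have hu' : u ∈ σ ∪ τ := by
      rcases Finset.mem_insert.mp hu with rfl | hu
      · exact Finset.mem_union_left _ hv.1
      · exact hsub hu
    rcases Finset.mem_union.mp hu' with h | h
    · exact L.down_closed hσf (by
        intro x hx
        rcases Finset.mem_insert.mp hx with rfl | hx
        · exact hv.1
        · rw [Finset.mem_singleton.mp hx]; exact h) ⟨v, by simp⟩
    · exact L.down_closed hτf (by
        intro x hx
        rcases Finset.mem_insert.mp hx with rfl | hx
        · exact hv.2
        · rw [Finset.mem_singleton.mp hx]; exact h) ⟨v, by simp⟩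
  have hface : insert v Δ ∈ L.faces := by
    refine hflag _ ⟨v, by simp⟩ ?_
    intro u hu w hw
    rcases Finset.mem_insert.mp hu with rfl | hu'
    · exact key w hw
    · rcases Finset.mem_insert.mp hw with rfl | hw'
      · rw [Finset.pair_comm]; exact key u hu
      · exact L.down_closed hΔf (by
          intro x hx
          rcases Finset.mem_insert.mp hx with rfl | hx
          · exact hu'
          · rw [Finset.mem_singleton.mp hx]; exact hw') ⟨u, by simp⟩
  have h1 := hdim.1 _ hface
  rw [Finset.card_insert_of_notMem hvΔ] at h1
  omega
end
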